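/- Let d, g, ρ₀ ∈ ℝ, let ξ : ℝ → ℝ be continuously differentiable with ξ(x) + d ≠ 0 for all x, let ζ : ℝ → ℝ be continuously differentiable, let ψ be twice continuously differentiable on an open neighborhood of the graph S = {(x,ξ(x)) : x ∈ ℝ}, and let U be continuously differentiable on a neighborhood of S. Define v(x,y) = U(x,y) − ψ_y(x,y)·(y+d)ζ(x)/(ξ(x)+d). Then at every point (x, ξ(x)): ψ_x v_x + ψ_y v_y + (ψ_x ψ_{xy} + ψ_y ψ_{yy} + gρ₀) ζ = ψ_x U_x + ψ_y U_y + gρ₀ ζ − ψ_x ψ_y (ξ(x)+d)·(ζ/(ξ+d))'(x) − ψ_y² ζ(x)/(ξ(x)+d), where all derivatives of ψ, U, v are evaluated at (x, ξ(x)). -/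

import Mathlib

/-- partial derivative in `x` of a real-valued function on `ℝ²`. -/
noncomputable def pdx (f : ℝ × ℝ → ℝ) (p : ℝ × ℝ) : ℝ :=
  deriv (fun t => f (t, p.2)) p.1

/-- partial derivative in `y` of a real-valued function on `ℝ²`. -/
noncomputable def pdy (f : ℝ × ℝ → ℝ) (p : ℝ × ℝ) : ℝ :=
  deriv (fun t => f (p.1, t)) p.2

theorem DifferentiableAt.hasDerivAt_pdx {f : ℝ × ℝ → ℝ} {p : ℝ × ℝ}
    (hf : DifferentiableAt ℝ f p) :
    HasDerivAt (fun t => f (t, p.2)) (pdx f p) p.1 :=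
  (DifferentiableAt.comp (g := f) p.1 hf
    (differentiableAt_id.prodMk (differentiableAt_const p.2))).hasDerivAt

theorem DifferentiableAt.hasDerivAt_pdy {f : ℝ × ℝ → ℝ} {p : ℝ × ℝ}
    (hf : DifferentiableAt ℝ f p) :
    HasDerivAt (fun t => f (p.1, t)) (pdy f p) p.2 :=
  (DifferentiableAt.comp (g := f) p.2 hf
    ((differentiableAt_const p.1).prodMk differentiableAt_id)).hasDerivAt

theorem DifferentiableAt.pdx_eq_fderiv {f : ℝ × ℝ → ℝ} {p : ℝ × ℝ}
    (hf : DifferentiableAt ℝ f p) : pdx f p = fderiv ℝ f p (1, 0) :=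
  (HasFDerivAt.comp_hasDerivAt (l := f) p.1 hf.hasFDerivAt
    ((hasDerivAt_id p.1).prodMk (hasDerivAt_const p.1 p.2))).deriv

theorem DifferentiableAt.pdy_eq_fderiv {f : ℝ × ℝ → ℝ} {p : ℝ × ℝ}
    (hf : DifferentiableAt ℝ f p) : pdy f p = fderiv ℝ f p (0, 1) :=
  (HasFDerivAt.comp_hasDerivAt (l := f) p.2 hf.hasFDerivAt
    ((hasDerivAt_const p.2 p.1).prodMk (hasDerivAt_id p.2))).deriv

section SecondOrder

variable {f : ℝ × ℝ → ℝ} {p : ℝ × ℝ}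

theorem ContDiffAt.eventually_differentiableAt_of_two (hf : ContDiffAt ℝ 2 f p) :
    ∀ᶠ q in nhds p, DifferentiableAt ℝ f q :=
  (hf.eventually (by simp)).mono fun _ hq => hq.differentiableAt (by simp)

theorem ContDiffAt.hasFDerivAt_fderiv_of_two (hf : ContDiffAt ℝ 2 f p) :
    HasFDerivAt (fderiv ℝ f) (fderiv ℝ (fderiv ℝ f) p) p :=
  ((hf.fderiv_right (m := 1) (by norm_num)).differentiableAt (by simp)).hasFDerivAt

theorem ContDiffAt.hasFDerivAt_pdx (hf : ContDiffAt ℝ 2 f p) :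
    HasFDerivAt (pdx f)
      ((ContinuousLinearMap.apply ℝ ℝ ((1, 0) : ℝ × ℝ)).comp (fderiv ℝ (fderiv ℝ f) p)) p :=
  ((ContinuousLinearMap.apply ℝ ℝ ((1, 0) : ℝ × ℝ)).hasFDerivAt.comp p
    hf.hasFDerivAt_fderiv_of_two).congr_of_eventuallyEq
    (hf.eventually_differentiableAt_of_two.mono fun _ hq => hq.pdx_eq_fderiv)

theorem ContDiffAt.hasFDerivAt_pdy (hf : ContDiffAt ℝ 2 f p) :
    HasFDerivAt (pdy f)
      ((ContinuousLinearMap.apply ℝ ℝ ((0, 1) : ℝ × ℝ)).comp (fderiv ℝ (fderiv ℝ f) p)) p :=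
  ((ContinuousLinearMap.apply ℝ ℝ ((0, 1) : ℝ × ℝ)).hasFDerivAt.comp p
    hf.hasFDerivAt_fderiv_of_two).congr_of_eventuallyEq
    (hf.eventually_differentiableAt_of_two.mono fun _ hq => hq.pdy_eq_fderiv)

/-- Symmetry of the mixed second partial derivatives. -/
theorem ContDiffAt.pdx_pdy_comm (hf : ContDiffAt ℝ 2 f p) :
    pdx (pdy f) p = pdy (pdx f) p := by
  rw [hf.hasFDerivAt_pdy.differentiableAt.pdx_eq_fderiv,
    hf.hasFDerivAt_pdx.differentiableAt.pdy_eq_fderiv,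
    hf.hasFDerivAt_pdy.fderiv, hf.hasFDerivAt_pdx.fderiv]
  exact (hf.isSymmSndFDerivAt (by simp)).eq (1, 0) (0, 1)

end SecondOrder

/-- boundary identity relating the flattened Frechet
derivative to the formal one: with
`v = U − ψ_y (y+d)ζ/(ξ+d)`, on the surface `y = ξ(x)` one has
`ψ_x v_x + ψ_y v_y + (ψ_x ψ_{xy} + ψ_y ψ_{yy} + gρ₀)ζ
  = ψ_x U_x + ψ_y U_y + gρ₀ ζ − ψ_x ψ_y (ξ+d)(ζ/(ξ+d))' − ψ_y² ζ/(ξ+d)`. -/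
theorem stmt_10 (d g ρ₀ : ℝ) (ξ : ℝ → ℝ) (hξ : ContDiff ℝ 1 ξ)
    (hξd : ∀ x : ℝ, ξ x + d ≠ 0)
    (ζ : ℝ → ℝ) (hζ : ContDiff ℝ 1 ζ)
    (O : Set (ℝ × ℝ)) (hO : IsOpen O) (hSO : ∀ x : ℝ, (x, ξ x) ∈ O)
    (ψ : ℝ × ℝ → ℝ) (hψ : ContDiffOn ℝ 2 ψ O)
    (U : ℝ × ℝ → ℝ) (hU : ContDiffOn ℝ 1 U O)
    (v : ℝ × ℝ → ℝ)
    (hv : v = fun p => U p - pdy ψ p * ((p.2 + d) * ζ p.1 / (ξ p.1 + d))) :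
    ∀ x : ℝ,
      pdx ψ (x, ξ x) * pdx v (x, ξ x) + pdy ψ (x, ξ x) * pdy v (x, ξ x) +
        (pdx ψ (x, ξ x) * pdy (pdx ψ) (x, ξ x) +
          pdy ψ (x, ξ x) * pdy (pdy ψ) (x, ξ x) + g * ρ₀) * ζ x =
      pdx ψ (x, ξ x) * pdx U (x, ξ x) + pdy ψ (x, ξ x) * pdy U (x, ξ x) +
        g * ρ₀ * ζ x -
        pdx ψ (x, ξ x) * pdy ψ (x, ξ x) * (ξ x + d) *
          deriv (fun t => ζ t / (ξ t + d)) x -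
        (pdy ψ (x, ξ x)) ^ 2 * ζ x / (ξ x + d) := by
  intro x
  have hmem : O ∈ nhds (x, ξ x) := hO.mem_nhds (hSO x)
  have hψx : ContDiffAt ℝ 2 ψ (x, ξ x) := hψ.contDiffAt hmem
  have hUx : DifferentiableAt ℝ U (x, ξ x) :=
    (hU.contDiffAt hmem).differentiableAt (by simp)
  have hψy : DifferentiableAt ℝ (pdy ψ) (x, ξ x) := hψx.hasFDerivAt_pdy.differentiableAt
  have hne := hξd x
  have hquot : HasDerivAt (fun t => ζ t / (ξ t + d))
      (deriv (fun t => ζ t / (ξ t + d)) x) x :=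
    ((hζ.differentiable (by simp) x).div
      ((hξ.differentiable (by simp) x).add_const d) hne).hasDerivAt
  have hvx : pdx v (x, ξ x) = pdx U (x, ξ x) -
      (pdx (pdy ψ) (x, ξ x) * ((ξ x + d) * (ζ x / (ξ x + d))) +
        pdy ψ (x, ξ x) * ((ξ x + d) * deriv (fun t => ζ t / (ξ t + d)) x)) := by
    simp only [hv, mul_div_assoc]
    exact (hUx.hasDerivAt_pdx.sub
      (hψy.hasDerivAt_pdx.mul (hquot.const_mul (ξ x + d)))).deriv
  have hvy : pdy v (x, ξ x) = pdy U (x, ξ x) -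
      (pdy (pdy ψ) (x, ξ x) * ((ξ x + d) * (ζ x / (ξ x + d))) +
        pdy ψ (x, ξ x) * (1 * (ζ x / (ξ x + d)))) := by
    simp only [hv, mul_div_assoc]
    exact (hUx.hasDerivAt_pdy.sub (hψy.hasDerivAt_pdy.mul
      (((hasDerivAt_id (ξ x)).add_const d).mul_const (ζ x / (ξ x + d))))).deriv
  rw [hvx, hvy, hψx.pdx_pdy_comm, mul_div_cancel₀ _ hne]
  ring
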